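/- Let G = (V,E) be a finite connected graph with nonempty disjoint source sets S1, S2 ⊆ V. If a configuration σ_0 : V → {1,2} has no blue blocking set over a red blocking set, then for every integer t ≥ 0, every configuration σ_t obtained from σ_0 by t full competitive-erosion steps (each consisting of one blue half-move followed by one red half-move) also has no blue blocking set over a red blocking set. -/

import Mathlib

/- STATEMENT 3: On a finite connected graph with disjoint nonempty source sets S1, S2,
   the property of having no blue blocking set over a red blocking set is preserved by
   full competitive-erosion steps (a blue half-move followed by a red half-move). -/

/-- Colors: `blue` corresponds to color 1, `red` to color 2. -/
inductive Color where
  | blue : Color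
  | red : Color
deriving DecidableEq

namespace CompErosion

variable {V : Type*} [DecidableEq V] (G : SimpleGraph V) (S1 S2 : Set V)

/-- A blue half-move: recolor blue a single red vertex `x` reachable from `S1` by a path
all of whose vertices except possibly `x` are blue (`j = 0` allowed). -/
def BlueMove (σ σ' : V → Color) : Prop :=
  ∃ x : V, σ x = Color.red ∧
    (∃ s : V, s ∈ S1 ∧ ∃ p : G.Walk s x, ∀ v ∈ p.support, v ≠ x → σ v = Color.blue) ∧
    σ' = Function.update σ x Color.blue

/-- A red half-move: recolor red a single blue vertex `y` reachable from `S2` by a path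
all of whose vertices except possibly `y` are red. -/
def RedMove (σ σ' : V → Color) : Prop :=
  ∃ y : V, σ y = Color.blue ∧
    (∃ s : V, s ∈ S2 ∧ ∃ p : G.Walk s y, ∀ v ∈ p.support, v ≠ y → σ v = Color.red) ∧
    σ' = Function.update σ y Color.red

/-- A full competitive-erosion step: one blue half-move followed by one red half-move. -/
def ErosionStep (σ σ'' : V → Color) : Prop :=
  ∃ σ' : V → Color, BlueMove G S1 σ σ' ∧ RedMove G S2 σ' σ''

/-- `A` is blocking: every walk from `S1` to `S2` meets `A` (so `S1 ∖ A` and `S2 ∖ A` lie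
in different components of `V ∖ A`). -/
def Blocking (A : Set V) : Prop :=
  ∀ s1 ∈ S1, ∀ s2 ∈ S2, ∀ p : G.Walk s1 s2, ∃ v ∈ p.support, v ∈ A

/-- `A` is over `B`: (1) `A` and `S1 ∖ B` lie in different components of `V ∖ B`;
(2) `B` and `S2 ∖ A` lie in different components of `V ∖ A`. -/
def Over (A B : Set V) : Prop :=
  (∀ a ∈ A, ∀ s ∈ S1, ∀ p : G.Walk s a, ∃ v ∈ p.support, v ∈ B) ∧
  (∀ b ∈ B, ∀ s ∈ S2, ∀ p : G.Walk s b, ∃ v ∈ p.support, v ∈ A)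

/-- `σ` has a blue blocking set over a red blocking set. -/
def HasBlueOverRed (σ : V → Color) : Prop :=
  ∃ A B : Set V, A ⊆ {v | σ v = Color.blue} ∧ B ⊆ {v | σ v = Color.red} ∧
    Disjoint A B ∧ Blocking G S1 S2 A ∧ Blocking G S1 S2 B ∧ Over G S1 S2 A B

end CompErosion

open CompErosion

namespace CompErosion

variable {V : Type*} [DecidableEq V] {G : SimpleGraph V} {S1 S2 : Set V} {σ σ' : V → Color}

/-- A blue half-move cannot create a blue blocking set over a red blocking set: the recolored
vertex is joined to `S1` by a blue path, so it does not lie in the blue set. -/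
theorem HasBlueOverRed.of_blueMove (hm : BlueMove G S1 σ σ') (h : HasBlueOverRed G S1 S2 σ') :
    HasBlueOverRed G S1 S2 σ := by
  obtain ⟨x, -, ⟨s, hs, p, hp⟩, rfl⟩ := hm
  obtain ⟨A, B, hA, hB, hAB, hbA, hbB, hover⟩ := h
  have hne : ∀ v ∈ B, v ≠ x := by
    rintro v hv rfl
    simpa using hB hv
  have hBσ : B ⊆ {v | σ v = Color.red} := fun v hv => by
    simpa [Function.update_of_ne (hne v hv)] using hB hv
  have hxA : x ∉ A := fun hx => by
    obtain ⟨v, hvp, hvB⟩ := hover.1 x hx s hs p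
    simpa [hp v hvp (hne v hvB)] using hBσ hvB
  refine ⟨A, B, fun v hv => ?_, hBσ, hAB, hbA, hbB, hover⟩
  simpa [Function.update_of_ne (ne_of_mem_of_not_mem hv hxA)] using hA hv

/-- A red half-move cannot create a blue blocking set over a red blocking set: the recolored
vertex is joined to `S2` by a red path, so it does not lie in the red set. -/
theorem HasBlueOverRed.of_redMove (hm : RedMove G S2 σ σ') (h : HasBlueOverRed G S1 S2 σ') :
    HasBlueOverRed G S1 S2 σ := by
  obtain ⟨y, -, ⟨s, hs, p, hp⟩, rfl⟩ := hm
  obtain ⟨A, B, hA, hB, hAB, hbA, hbB, hover⟩ := h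
  have hne : ∀ v ∈ A, v ≠ y := by
    rintro v hv rfl
    simpa using hA hv
  have hAσ : A ⊆ {v | σ v = Color.blue} := fun v hv => by
    simpa [Function.update_of_ne (hne v hv)] using hA hv
  have hyB : y ∉ B := fun hy => by
    obtain ⟨v, hvp, hvA⟩ := hover.2 y hy s hs p
    simpa [hp v hvp (hne v hvA)] using hAσ hvA
  refine ⟨A, B, hAσ, fun v hv => ?_, hAB, hbA, hbB, hover⟩
  simpa [Function.update_of_ne (ne_of_mem_of_not_mem hv hyB)] using hB hv

end CompErosion

theorem no_blueOverRed_invariant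
    {V : Type*} [Fintype V] [DecidableEq V] (G : SimpleGraph V) (hG : G.Connected)
    (S1 S2 : Set V) (hS1 : S1.Nonempty) (hS2 : S2.Nonempty) (hdisj : Disjoint S1 S2)
    (σ0 : V → Color) (h0 : ¬ HasBlueOverRed G S1 S2 σ0)
    (σt : V → Color)
    (hreach : Relation.ReflTransGen (ErosionStep G S1 S2) σ0 σt) :
    ¬ HasBlueOverRed G S1 S2 σt := by
  induction hreach with
  | refl => exact h0
  | tail _ hstep ih =>
    obtain ⟨_, hblue, hred⟩ := hstep
    exact fun h => ih ((h.of_redMove hred).of_blueMove hblue)
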